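/- arXiv:2402.07866 — 14 statements merged into one kernel-verified Lean document; each statement's English description precedes it below -/
import Mathlib

section
/- Let d ≥ 1 and let E : Fin K → Matrix (Fin d) (Fin d) ℂ be a family of matrices satisfying the orthogonality condition Tr(E i * (E j)ᴴ) = d·δ_{ij} for all i, j, and let p : Fin K → ℝ be a family of nonnegative coefficients. Then for every M ≥ 1 and all matrices ρ, O ∈ Matrix (Fin d) (Fin d) ℂ, the M-fold virtual-channel-purification expectation value satisfies: ∑ over all tuples (i₁,…,i_M) ∈ (Fin K)^M of (∏_{m=1}^M p_{i_m}) · Tr(E_{i_M} ρ (E_{i_1})ᴴ O) · ∏_{m=1}^{M-1} d⁻¹ Tr(E_{i_m} (E_{i_{m+1}})ᴴ) = ∑_{i} p_i^M · Tr(E_i ρ (E_i)ᴴ O). -/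
open Matrix BigOperators

/-- A sequence whose consecutive terms agree is constant. -/
theorem eq_const_of_castSucc_eq_succ {α : Type*} {n : ℕ} {f : Fin (n + 1) → α}
    (h : ∀ m : Fin n, f m.castSucc = f m.succ) : f = fun _ => f 0 := by
  funext m
  induction m using Fin.induction with
  | zero => rfl
  | succ m ih => rw [← h m, ih]

/-- A sum over sequences weighted by a chain of Kronecker deltas between consecutive terms
reduces to a sum over constant sequences. -/
theorem sum_mul_prod_ite_castSucc_eq_succ {α R : Type*} [Fintype α] [DecidableEq α]
    [CommSemiring R] {n : ℕ} (F : (Fin (n + 1) → α) → R) :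
    ∑ f, F f * ∏ m : Fin n, (if f m.castSucc = f m.succ then 1 else 0) =
      ∑ a, F fun _ => a := by
  refine (Finset.sum_of_injOn (fun a _ => a) ?_ (by simp) ?_ (by simp)).symm
  · exact fun a _ b _ hab => congrFun hab 0
  · intro f _ hf
    obtain ⟨m, hm⟩ : ∃ m : Fin n, f m.castSucc ≠ f m.succ := by
      by_contra! h
      exact hf ⟨f 0, by simp, (eq_const_of_castSucc_eq_succ h).symm⟩
    rw [Finset.prod_eq_zero (Finset.mem_univ m) (if_neg hm), mul_zero]

/-- M-th order virtual channel purification expectation value (Theorem 1 numerator),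
with `M = n + 1 ≥ 1`. -/
theorem vcp_expectation_value
    (d K : ℕ) (hd : 1 ≤ d)
    (E : Fin K → Matrix (Fin d) (Fin d) ℂ)
    (horth : ∀ i j, (E i * (E j)ᴴ).trace = if i = j then (d : ℂ) else 0)
    (p : Fin K → ℝ) (hp : ∀ i, 0 ≤ p i)
    (n : ℕ) (ρ O : Matrix (Fin d) (Fin d) ℂ) :
    ∑ f : Fin (n + 1) → Fin K,
      (∏ m, (p (f m) : ℂ)) *
        (E (f (Fin.last n)) * ρ * (E (f 0))ᴴ * O).trace *
        ∏ m : Fin n, (d : ℂ)⁻¹ * (E (f m.castSucc) * (E (f m.succ))ᴴ).trace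
      = ∑ i, (p i : ℂ) ^ (n + 1) * (E i * ρ * (E i)ᴴ * O).trace := by
  have hd' : (d : ℂ) ≠ 0 := by exact_mod_cast Nat.one_le_iff_ne_zero.mp hd
  simp only [horth, mul_ite, mul_zero, inv_mul_cancel₀ hd']
  rw [sum_mul_prod_ite_castSucc_eq_succ (fun f : Fin (n + 1) → Fin K =>
    (∏ m, (p (f m) : ℂ)) * (E (f (Fin.last n)) * ρ * (E (f 0))ᴴ * O).trace)]
  simp
end

section
/- Let d ≥ 1 and let E : Fin K → Matrix (Fin d) (Fin d) ℂ satisfy Tr(E i * (E j)ᴴ) = d·δ_{ij}, and let p : Fin K → ℝ be nonnegative with ∑_i p_i = 1. Then for all matrices ρ, O ∈ Matrix (Fin d) (Fin d) ℂ: (1/4) ∑_{i,j} (p_i p_j / d) · [Tr(O E_i ρ (E_i)ᴴ)·Tr(E_j (E_j)ᴴ) + Tr(O E_i ρ (E_j)ᴴ)·Tr(E_j (E_i)ᴴ) + Tr(O E_j ρ (E_j)ᴴ)·Tr(E_i (E_i)ᴴ) + Tr(O E_j ρ (E_i)ᴴ)·Tr(E_i (E_j)ᴴ)] = (1/2)·[∑_i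 p_i Tr(O E_i ρ (E_i)ᴴ) + ∑_i p_i² Tr(O E_i ρ (E_i)ᴴ)]. -/
open Matrix BigOperators

/-- Post-selected (+ outcome) expectation value of the second-order VCP circuit:
`⟨|+⟩⟨+| ⊗ O⟩ = Tr[O (ℰ(ρ) + P₂ ℰ^(2)(ρ))/2]`. -/
theorem vcp_postselected_expectation
    (d K : ℕ) (hd : 1 ≤ d)
    (E : Fin K → Matrix (Fin d) (Fin d) ℂ)
    (horth : ∀ i j, (E i * (E j)ᴴ).trace = if i = j then (d : ℂ) else 0)
    (p : Fin K → ℝ) (hp : ∀ i, 0 ≤ p i) (hsum : ∑ i, p i = 1)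
    (ρ O : Matrix (Fin d) (Fin d) ℂ) :
    (1 / 4 : ℂ) * ∑ i, ∑ j, ((p i : ℂ) * (p j : ℂ) / (d : ℂ)) *
      ((O * (E i * ρ * (E i)ᴴ)).trace * (E j * (E j)ᴴ).trace
        + (O * (E i * ρ * (E j)ᴴ)).trace * (E j * (E i)ᴴ).trace
        + (O * (E j * ρ * (E j)ᴴ)).trace * (E i * (E i)ᴴ).trace
        + (O * (E j * ρ * (E i)ᴴ)).trace * (E i * (E j)ᴴ).trace)
    = (1 / 2 : ℂ) * ((∑ i, (p i : ℂ) * (O * (E i * ρ * (E i)ᴴ)).trace)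
        + ∑ i, (p i : ℂ) ^ 2 * (O * (E i * ρ * (E i)ᴴ)).trace) := by
  have hd0 : (d : ℂ) ≠ 0 := Nat.cast_ne_zero.mpr (by omega)
  have hsumC : ∑ i, (p i : ℂ) = 1 := by exact_mod_cast hsum
  set a : Fin K → ℂ := fun i => (O * (E i * ρ * (E i)ᴴ)).trace with ha
  have hterm : ∀ i j, ((p i : ℂ) * (p j : ℂ) / (d : ℂ)) *
      ((O * (E i * ρ * (E i)ᴴ)).trace * (E j * (E j)ᴴ).trace
        + (O * (E i * ρ * (E j)ᴴ)).trace * (E j * (E i)ᴴ).trace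
        + (O * (E j * ρ * (E j)ᴴ)).trace * (E i * (E i)ᴴ).trace
        + (O * (E j * ρ * (E i)ᴴ)).trace * (E i * (E j)ᴴ).trace)
      = (p i * a i) * p j + p i * (p j * a j)
        + if i = j then 2 * ((p i : ℂ) ^ 2 * a i) else 0 := by
    intro i j
    simp only [horth, ha]
    by_cases h : i = j
    · subst h
      simp only [if_true]
      field_simp
      ring
    · simp only [if_true, if_neg h, if_neg (Ne.symm h)]
      field_simp
      ring
  simp only [hterm, Finset.sum_add_distrib, Finset.sum_ite_eq, Finset.mem_univ, if_true,
    ← Finset.mul_sum, ← Finset.sum_mul, hsumC]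
  ring
end

section
/- Let d ≥ 1 and let E : Fin K → Matrix (Fin d) (Fin d) ℂ satisfy Tr(E i * (E j)ᴴ) = d·δ_{ij} with each E_i unitary ((E_i)ᴴ * E_i = 1). Let p : Fin K → ℝ be nonnegative with ∑_i p_i = 1, and let ρ be a matrix with Tr ρ = 1. Then the probability of measuring + on the control qubit of the second-order channel purification circuit satisfies (1/4) ∑_{i,j} (p_i p_j / d) · [Tr(E_i ρ (E_i)ᴴ)·Tr(E_j (E_j)ᴴ) + Tr(E_i ρ (E_j)ᴴ)·Tr(E_j (E_i)ᴴ) + Tr(E_j ρ (E_j)ᴴ)·Tr(E_i (E_i)ᴴ) + Tr(E_j ρ (E_i)ᴴ)·Tr(E_i (E_j)ᴴ)] = (1/2)·(1 + ∑_i p_i²). -/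
open Matrix BigOperators

/-- The post-selection success probability of the second-order channel purification
circuit: `p₊ = (1 + P₂)/2` (part of Corollary 1). -/
theorem vcp_postselection_probability
    (d K : ℕ) (hd : 1 ≤ d)
    (E : Fin K → Matrix (Fin d) (Fin d) ℂ)
    (horth : ∀ i j, (E i * (E j)ᴴ).trace = if i = j then (d : ℂ) else 0)
    (hunit : ∀ i, (E i)ᴴ * E i = 1)
    (p : Fin K → ℝ) (hp : ∀ i, 0 ≤ p i) (hsum : ∑ i, p i = 1)
    (ρ : Matrix (Fin d) (Fin d) ℂ) (hρ : ρ.trace = 1) :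
    (1 / 4 : ℂ) * ∑ i, ∑ j, ((p i : ℂ) * (p j : ℂ) / (d : ℂ)) *
      ((E i * ρ * (E i)ᴴ).trace * (E j * (E j)ᴴ).trace
        + (E i * ρ * (E j)ᴴ).trace * (E j * (E i)ᴴ).trace
        + (E j * ρ * (E j)ᴴ).trace * (E i * (E i)ᴴ).trace
        + (E j * ρ * (E i)ᴴ).trace * (E i * (E j)ᴴ).trace)
    = (1 / 2 : ℂ) * (1 + ∑ i, (p i : ℂ) ^ 2) := by
  have hd0 : (d : ℂ) ≠ 0 := Nat.cast_ne_zero.mpr (by omega)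
  have htr : ∀ i, (E i * ρ * (E i)ᴴ).trace = 1 := fun i => by
    rw [Matrix.trace_mul_comm, ← Matrix.mul_assoc, hunit, Matrix.one_mul, hρ]
  have hterm : ∀ i j, ((p i : ℂ) * (p j : ℂ) / (d : ℂ)) *
      ((E i * ρ * (E i)ᴴ).trace * (E j * (E j)ᴴ).trace
        + (E i * ρ * (E j)ᴴ).trace * (E j * (E i)ᴴ).trace
        + (E j * ρ * (E j)ᴴ).trace * (E i * (E i)ᴴ).trace
        + (E j * ρ * (E i)ᴴ).trace * (E i * (E j)ᴴ).trace)
      = 2 * ((p i : ℂ) * (p j : ℂ)) + if i = j then 2 * (p i : ℂ) ^ 2 else 0 := by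
    intro i j
    by_cases h : i = j
    · subst h
      simp only [horth, htr, if_true]
      field_simp
      ring
    · simp only [horth, htr, if_true, if_neg h, if_neg (Ne.symm h)]
      field_simp
      ring
  have hsumC : ∑ i, (p i : ℂ) = 1 := by exact_mod_cast hsum
  simp only [hterm, Finset.sum_add_distrib, Finset.sum_ite_eq, Finset.mem_univ, if_true,
    ← Finset.mul_sum, hsumC, mul_one]
  ring
end

section
/- Let d ≥ 1 and let E : Fin K → Matrix (Fin d) (Fin d) ℂ satisfy Tr(E i * (E j)ᴴ) = d·δ_{ij}, and let p : Fin K → ℝ be nonnegative with ∑_i p_i = 1 and P_M := ∑_i p_i^M. Then for every M ≥ 1 and all matrices ρ, O: (1/2)·[ Tr(O · ∑_i p_i E_i ρ (E_i)ᴴ) + ∑ over tuples (i₁,…,i_M) of (∏_m p_{i_m}) Tr(E_{i_M} ρ (E_{i_1})ᴴ O) ∏_{m=1}^{M-1} d⁻¹ Tr(E_{i_m}(E_{i_{m+1}})ᴴ) ] = ((1 + P_M)/2) · Tr(O · ℰ₊(ρ)), where ℰ₊(ρ) := (1 + P_M)⁻¹ · (∑_i p_i E_i ρ (E_i)ᴴ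 + ∑_i p_i^M E_i ρ (E_i)ᴴ). -/
open Matrix BigOperators

theorem sum_mul_prod_ite_eq_succ {ι R : Type*} [Fintype ι] [DecidableEq ι] [CommSemiring R]
    {n : ℕ} (G : (Fin (n + 1) → ι) → R) :
    ∑ f, G f * ∏ m : Fin n, (if f m.castSucc = f m.succ then 1 else 0) =
      ∑ i, G (fun _ => i) := by
  symm
  refine Fintype.sum_of_injective (Function.const (Fin (n + 1)))
    Function.const_injective _ _ (fun f hf => ?_) (fun i => by simp [Function.const_def])
  obtain ⟨m, hm⟩ : ∃ m : Fin n, f m.castSucc ≠ f m.succ := by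
    by_contra! h
    refine hf ⟨f 0, funext fun j => ?_⟩
    induction j using Fin.induction with
    | zero => rfl
    | succ m ih => exact ih.trans (h m)
  rw [Finset.prod_eq_zero (Finset.mem_univ m) (if_neg hm), mul_zero]

/-- Corollary 1: the post-selected (+ outcome) expectation value of the M-th order
channel purification circuit equals `((1 + P_M)/2) · Tr(O ℰ₊(ρ))` with the effective
physically purified channel `ℰ₊ = (ℰ + P_M ℰ^(M))/(1 + P_M)`, `M = n + 1 ≥ 1`. -/
theorem vcp_physical_purification
    (d K : ℕ) (hd : 1 ≤ d)
    (E : Fin K → Matrix (Fin d) (Fin d) ℂ)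
    (horth : ∀ i j, (E i * (E j)ᴴ).trace = if i = j then (d : ℂ) else 0)
    (p : Fin K → ℝ) (hp : ∀ i, 0 ≤ p i) (hsum : ∑ i, p i = 1)
    (n : ℕ) (ρ O : Matrix (Fin d) (Fin d) ℂ) :
    (1 / 2 : ℂ) *
      ((O * ∑ i, (p i : ℂ) • (E i * ρ * (E i)ᴴ)).trace +
        ∑ f : Fin (n + 1) → Fin K,
          (∏ m, (p (f m) : ℂ)) *
            (E (f (Fin.last n)) * ρ * (E (f 0))ᴴ * O).trace *
            ∏ m : Fin n, (d : ℂ)⁻¹ * (E (f m.castSucc) * (E (f m.succ))ᴴ).trace)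
    = (((1 + ∑ i, p i ^ (n + 1)) / 2 : ℝ) : ℂ) *
      (O * ((((1 + ∑ i, p i ^ (n + 1) : ℝ)) : ℂ)⁻¹ •
        (∑ i, (p i : ℂ) • (E i * ρ * (E i)ᴴ) +
          ∑ i, (p i : ℂ) ^ (n + 1) • (E i * ρ * (E i)ᴴ)))).trace := by
  have hd0 : (d : ℂ) ≠ 0 := by exact_mod_cast (by lia : d ≠ 0)
  have hP : ((1 + ∑ i, p i ^ (n + 1) : ℝ) : ℂ) ≠ 0 := by
    have : 0 ≤ ∑ i, p i ^ (n + 1) := Finset.sum_nonneg fun i _ => pow_nonneg (hp i) _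
    exact_mod_cast (by linarith : 1 + ∑ i, p i ^ (n + 1) ≠ 0)
  have hoverlap (i j : Fin K) :
      (d : ℂ)⁻¹ * (E i * (E j)ᴴ).trace = if i = j then 1 else 0 := by
    rw [horth]; split_ifs <;> simp [hd0]
  simp_rw [hoverlap]
  rw [sum_mul_prod_ite_eq_succ fun f => (∏ m, (p (f m) : ℂ)) *
    (E (f (Fin.last n)) * ρ * (E (f 0))ᴴ * O).trace]
  have hcross : ∑ i, (∏ _m : Fin (n + 1), (p i : ℂ)) * (E i * ρ * (E i)ᴴ * O).trace =
      (O * ∑ i, (p i : ℂ) ^ (n + 1) • (E i * ρ * (E i)ᴴ)).trace := by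
    simp [Finset.mul_sum, trace_sum, trace_mul_comm O]
  rw [hcross, Matrix.mul_smul, trace_smul, Matrix.mul_add, trace_add, smul_eq_mul,
    Complex.ofReal_div, Complex.ofReal_ofNat]
  field_simp
end

section
/- Let d ≥ 1, let E : Fin K → Matrix (Fin d) (Fin d) ℂ with E_0 = 1 (the identity matrix), and let p : Fin K → ℝ be nonnegative with p_0 > 0. Suppose for each m ∈ {1,…,M−1} we have matrices σ_m, S_m satisfying the noise-removal condition Tr(S_m · E_i · σ_m · (E_j)ᴴ) = δ_{i0}·δ_{j0} for all i, j. Then for every matrix ρ with Tr ρ = 1 and every matrix O, the ratio (∑ over tuples (i₁,…,i_M) of (∏_m p_{i_m}) Tr(E_{i_M} ρ (E_{i_1})ᴴ O) ∏_{m=1}^{M-1} Tr(S_m E_{i_m} σ_m (E_{i_{m+1}})ᴴ)) / (∑ over tuples (i₁,…,i_M) of (∏_m p_{i_m}) Tr(E_{i_M} ρ (E_{i_1})ᴴ) ∏_{m=1}^{M-1} Tr(S_m E_{i_m} σ_m (E_{i_{m+1}})ᴴ)) = Tr(O ρ), i.e. all noise is removed and the noiseless expectation value is recovered exactly. -/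
open Matrix BigOperators

/-- A weight that forces all consecutive entries of a tuple to equal `i` selects the constant
tuple `i` from a sum over all tuples. -/
theorem sum_mul_prod_consecutive_eq_const {ι R : Type*} [Fintype ι] [DecidableEq ι]
    [CommSemiring R] (i : ι) (n : ℕ) (a : (Fin (n + 2) → ι) → R) :
    ∑ f : Fin (n + 2) → ι, a f *
      ∏ m : Fin (n + 1), (if f m.castSucc = i ∧ f m.succ = i then (1 : R) else 0) =
      a fun _ => i := by
  rw [Finset.sum_eq_single_of_mem (fun _ => i) (Finset.mem_univ _)]
  · simp
  · intro f _ hf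
    obtain ⟨m, hm⟩ := Function.ne_iff.mp hf
    suffices h : ∃ k : Fin (n + 1), ¬(f k.castSucc = i ∧ f k.succ = i) by
      obtain ⟨k, hk⟩ := h
      rw [Finset.prod_eq_zero (Finset.mem_univ k) (if_neg hk), mul_zero]
    induction m using Fin.cases with
    | zero => exact ⟨0, fun h => hm h.1⟩
    | succ k => exact ⟨k, fun h => hm h.2⟩

/-- Generalized VCP circuit with ancillas satisfying the noise-removal condition
`Tr(Sₘ Eᵢ σₘ Eⱼᴴ) = δ_{i0} δ_{j0}`: the ratio of circuit expectation values recovers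
the exact noiseless value `Tr(O ρ)`.  Here `M = n + 2 ≥ 2` copies are used, with
`M - 1 = n + 1` ancillary registers. -/
theorem generalized_vcp_noise_removal
    (d K : ℕ) (hd : 1 ≤ d) (hK : 0 < K)
    (E : Fin K → Matrix (Fin d) (Fin d) ℂ)
    (hE0 : E ⟨0, hK⟩ = 1)
    (p : Fin K → ℝ) (hp : ∀ i, 0 ≤ p i) (hp0 : 0 < p ⟨0, hK⟩)
    (n : ℕ)
    (σ S : Fin (n + 1) → Matrix (Fin d) (Fin d) ℂ)
    (hrem : ∀ m i j, (S m * E i * σ m * (E j)ᴴ).trace =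
      if i = ⟨0, hK⟩ ∧ j = ⟨0, hK⟩ then 1 else 0)
    (ρ : Matrix (Fin d) (Fin d) ℂ) (hρ : ρ.trace = 1)
    (O : Matrix (Fin d) (Fin d) ℂ) :
    (∑ f : Fin (n + 2) → Fin K,
      (∏ m, (p (f m) : ℂ)) *
        (E (f (Fin.last (n + 1))) * ρ * (E (f 0))ᴴ * O).trace *
        ∏ m : Fin (n + 1), (S m * E (f m.castSucc) * σ m * (E (f m.succ))ᴴ).trace) /
    (∑ f : Fin (n + 2) → Fin K,
      (∏ m, (p (f m) : ℂ)) *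
        (E (f (Fin.last (n + 1))) * ρ * (E (f 0))ᴴ).trace *
        ∏ m : Fin (n + 1), (S m * E (f m.castSucc) * σ m * (E (f m.succ))ᴴ).trace)
    = (O * ρ).trace := by
  have hp0' : (p ⟨0, hK⟩ : ℂ) ≠ 0 := by exact_mod_cast hp0.ne'
  simp only [hrem, sum_mul_prod_consecutive_eq_const, hE0, conjTranspose_one, one_mul, mul_one,
    hρ, Finset.prod_const]
  rw [mul_div_cancel_left₀ _ (pow_ne_zero _ hp0'), trace_mul_comm]
end

section
/- Let Π_C ∈ Matrix (Fin d) (Fin d) ℂ be a projector and E : Fin K → Matrix (Fin d) (Fin d) ℂ a family of matrices satisfying the Knill–Laflamme condition for a non-degenerate code: Π_C · (E_j)ᴴ · E_i · Π_C = δ_{ij} · Π_C for all i, j ∈ Fin K. Let σ_C be a matrix supported on the code space, i.e. σ_C · Π_C = σ_C and Π_C · σ_C = σ_C, with Tr σ_C = 1. Then Tr(E_i · σ_C · (E_j)ᴴ) = δ_{ij} for all i, j ∈ Fin K; in particular, the pair (σ_C, S = I) satisfies the purification condition of the generalized virtual channel purification circuit. -/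
open Matrix BigOperators

/-- Knill–Laflamme condition for a non-degenerate code implies the purification
condition `Tr(Eᵢ σ_C Eⱼᴴ) = δᵢⱼ` for any code state `σ_C` (with trivial
ancillary measurement `S = I`).  `PC` is the code-space projector `Π_C`. -/
theorem knill_laflamme_gives_purification_condition
    (d K : ℕ)
    (PC : Matrix (Fin d) (Fin d) ℂ)
    (hproj : PC * PC = PC) (hherm : PCᴴ = PC)
    (E : Fin K → Matrix (Fin d) (Fin d) ℂ)
    (hKL : ∀ i j, PC * (E j)ᴴ * E i * PC = if i = j then PC else 0)
    (σC : Matrix (Fin d) (Fin d) ℂ)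
    (hσ1 : σC * PC = σC) (hσ2 : PC * σC = σC)
    (htr : σC.trace = 1) :
    ∀ i j, (E i * σC * (E j)ᴴ).trace = if i = j then 1 else 0 := by
  intro i j
  calc (E i * σC * (E j)ᴴ).trace
      = (E i * (PC * σC * PC) * (E j)ᴴ).trace := by rw [hσ2, hσ1]
    _ = (E i * PC * (σC * PC * (E j)ᴴ)).trace := by simp only [Matrix.mul_assoc]
    _ = (σC * (PC * (E j)ᴴ * E i * PC)).trace := by
      rw [Matrix.trace_mul_comm]
      simp only [Matrix.mul_assoc]
    _ = if i = j then 1 else 0 := by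
      rw [hKL]
      split_ifs
      · rw [hσ1, htr]
      · rw [Matrix.mul_zero, Matrix.trace_zero]
end

section
/- Let Π_C ∈ Matrix (Fin d) (Fin d) ℂ be a projector and E : Fin K → Matrix (Fin d) (Fin d) ℂ satisfy the Knill–Laflamme condition Π_C · (E_j)ᴴ · E_i · Π_C = δ_{ij} · Π_C for all i, j, with E_0 = 1 (the identity matrix). Let σ_C satisfy σ_C · Π_C = σ_C, Π_C · σ_C = σ_C, and Tr σ_C = 1. Then Tr(E_i · σ_C · (E_j)ᴴ · Π_C) = δ_{i0} · δ_{j0} for all i, j ∈ Fin K; i.e. measuring the code projector Π_C on the ancillary code state satisfies the noise-removal condition of the generalized virtual channel purification circuit. -/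
open Matrix BigOperators

/-- Measuring the code projector `Π_C` (here `PC`) on the ancillary code state
satisfies the noise-removal condition: `Tr(Eᵢ σ_C Eⱼᴴ Π_C) = δ_{i0} δ_{j0}`. -/
theorem code_projector_gives_noise_removal_condition
    (d K : ℕ) (hK : 0 < K)
    (PC : Matrix (Fin d) (Fin d) ℂ)
    (hproj : PC * PC = PC) (hherm : PCᴴ = PC)
    (E : Fin K → Matrix (Fin d) (Fin d) ℂ)
    (hKL : ∀ i j, PC * (E j)ᴴ * E i * PC = if i = j then PC else 0)
    (hE0 : E ⟨0, hK⟩ = 1)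
    (σC : Matrix (Fin d) (Fin d) ℂ)
    (hσ1 : σC * PC = σC) (hσ2 : PC * σC = σC)
    (htr : σC.trace = 1) :
    ∀ i j, (E i * σC * (E j)ᴴ * PC).trace =
      if i = ⟨0, hK⟩ ∧ j = ⟨0, hK⟩ then 1 else 0 := by
  have hE : ∀ i, PC * E i * PC = if i = ⟨0, hK⟩ then PC else 0 := fun i => by
    simpa [hE0] using hKL i ⟨0, hK⟩
  have hEH : ∀ j, PC * (E j)ᴴ * PC = if j = ⟨0, hK⟩ then PC else 0 := fun j => by
    simpa [hE0, eq_comm] using hKL ⟨0, hK⟩ j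
  intro i j
  calc (E i * σC * (E j)ᴴ * PC).trace
      = (E i * (PC * σC * PC) * (E j)ᴴ * (PC * PC)).trace := by rw [hσ2, hσ1, hproj]
    _ = (PC * (E i * (PC * σC * PC) * (E j)ᴴ * PC)).trace := by
        rw [← Matrix.mul_assoc _ PC PC, Matrix.trace_mul_comm]
    _ = ((PC * E i * PC) * σC * (PC * (E j)ᴴ * PC)).trace := by
        simp only [Matrix.mul_assoc]
    _ = if i = ⟨0, hK⟩ ∧ j = ⟨0, hK⟩ then 1 else 0 := by
        rw [hE, hEH]
        by_cases hi : i = ⟨0, hK⟩ <;> by_cases hj : j = ⟨0, hK⟩ <;>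
          simp [hi, hj, hσ1, hσ2, htr]
end

section
/- Let Π_C ∈ Matrix (Fin d) (Fin d) ℂ be a projector and E : Fin K → Matrix (Fin d) (Fin d) ℂ satisfy the Knill–Laflamme condition Π_C · (E_j)ᴴ · E_i · Π_C = δ_{ij} · Π_C for all i, j. Let σ_C satisfy σ_C · Π_C = σ_C and Π_C · σ_C = σ_C. Then for all i₁, i₂, j ∈ Fin K, projecting onto the j-th syndrome subspace gives (E_j · Π_C · (E_j)ᴴ) · (E_{i₁} · σ_C · (E_{i₂})ᴴ) · (E_j · Π_C · (E_j)ᴴ) = δ_{i₁ j} · δ_{i₂ j} · E_j · σ_C · (E_j)ᴴ. -/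
open Matrix BigOperators

/-- Projecting the ancillary-register operator `E_{i₁} σ_C E_{i₂}ᴴ` onto the `j`-th
syndrome subspace `E_j Π_C E_jᴴ` gives `δ_{i₁ j} δ_{i₂ j} E_j σ_C E_jᴴ`. -/
theorem syndrome_projection_of_virtual_state
    (d K : ℕ)
    (PC : Matrix (Fin d) (Fin d) ℂ)
    (hproj : PC * PC = PC) (hherm : PCᴴ = PC)
    (E : Fin K → Matrix (Fin d) (Fin d) ℂ)
    (hKL : ∀ i j, PC * (E j)ᴴ * E i * PC = if i = j then PC else 0)
    (σC : Matrix (Fin d) (Fin d) ℂ)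
    (hσ1 : σC * PC = σC) (hσ2 : PC * σC = σC) :
    ∀ i₁ i₂ j : Fin K,
      (E j * PC * (E j)ᴴ) * (E i₁ * σC * (E i₂)ᴴ) * (E j * PC * (E j)ᴴ) =
        if i₁ = j ∧ i₂ = j then E j * σC * (E j)ᴴ else 0 := by
  intro i₁ i₂ j
  have hσ : σC = PC * σC * PC := by rw [hσ2, hσ1]
  calc (E j * PC * (E j)ᴴ) * (E i₁ * σC * (E i₂)ᴴ) * (E j * PC * (E j)ᴴ)
      = (E j * PC * (E j)ᴴ) * (E i₁ * (PC * σC * PC) * (E i₂)ᴴ) * (E j * PC * (E j)ᴴ) := by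
        rw [← hσ]
    _ = E j * (PC * (E j)ᴴ * E i₁ * PC) * σC * (PC * (E i₂)ᴴ * E j * PC) * (E j)ᴴ := by
        simp only [Matrix.mul_assoc]
    _ = if i₁ = j ∧ i₂ = j then E j * σC * (E j)ᴴ else 0 := by
        rw [hKL i₁ j, hKL j i₂]
        by_cases h₁ : i₁ = j <;> by_cases h₂ : i₂ = j
        · simp [h₁, h₂, Matrix.mul_assoc (E j), hσ2, hσ1]
        · simp [h₂, Ne.symm h₂]
        · simp [h₁]
        · simp [h₁]
end

section
/- Let Π_C ∈ Matrix (Fin d) (Fin d) ℂ be a projector and E : Fin K → Matrix (Fin d) (Fin d) ℂ satisfy the Knill–Laflamme condition Π_C · (E_j)ᴴ · E_i · Π_C = δ_{ij} · Π_C for all i, j, with each E_j unitary ((E_j)ᴴ · E_j = 1). Let σ_C satisfy σ_C Π_C = Π_C σ_C = σ_C and Tr σ_C = 1, let p : Fin K → ℝ, and let T := ∑_{i₁, i₂} p_{i₁} p_{i₂} · (E_{i₂} ρ (E_{i₁})ᴴ) ⊗ (E_{i₁} σ_C (E_{i₂})ᴴ) (Kronecker product). Then for every matrix ρ and every observable O: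 ∑_j Tr[ ((E_j · O · (E_j)ᴴ) ⊗ (E_j · Π_C · (E_j)ᴴ)) · T ] = (∑_j p_j²) · Tr(O · ρ). That is, measuring the syndrome on the ancillary register and applying the corresponding correction to the main register recovers the completely noiseless expectation value, with overall normalisation ∑_j p_j² equal to that of second-order purification. -/
open Matrix Kronecker BigOperators

/-- Under the Knill–Laflamme condition, projecting `Eₐ σ E_bᴴ` onto syndrome `j` leaves a nonzero
trace only if `a = b = j`. -/
theorem trace_syndrome_mul_of_knillLaflamme {n ι : Type*} [Fintype n] [DecidableEq ι]
    {P σ : Matrix n n ℂ} {E : ι → Matrix n n ℂ}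
    (hKL : ∀ i j, P * (E j)ᴴ * E i * P = if i = j then P else 0)
    (hσP : σ * P = σ) (hPσ : P * σ = σ) (j a b : ι) :
    ((E j * P * (E j)ᴴ) * (E a * σ * (E b)ᴴ)).trace =
      if a = j then if b = j then σ.trace else 0 else 0 := by
  have h : (E j * P * (E j)ᴴ) * (E a * σ * (E b)ᴴ)
      = E j * ((P * (E j)ᴴ * E a * P) * σ * (E b)ᴴ) := by
    simp only [Matrix.mul_assoc]
    rw [← Matrix.mul_assoc P σ, hPσ]
  rw [h, hKL]
  split_ifs with ha hb
  · subst ha hb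
    rw [hPσ, Matrix.trace_mul_comm, ← hσP, ← hPσ]
    have h' : P * σ * P * (E b)ᴴ * E b = P * (σ * (P * (E b)ᴴ * E b)) := by
      simp only [Matrix.mul_assoc]
    rw [h', Matrix.trace_mul_comm, Matrix.mul_assoc, hKL, if_pos rfl, hPσ, hσP]
  · rw [hPσ, Matrix.trace_mul_comm, ← hσP, ← hPσ]
    have h' : P * σ * P * (E b)ᴴ * E j = P * (σ * (P * (E b)ᴴ * E j)) := by
      simp only [Matrix.mul_assoc]
    rw [h', Matrix.trace_mul_comm, Matrix.mul_assoc, hKL, if_neg (Ne.symm hb)]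
    simp
  · simp

/-- Conjugating both factors by the same isometry preserves the trace of their product. -/
theorem trace_conj_mul_conj {n : Type*} [Fintype n] [DecidableEq n] {U : Matrix n n ℂ}
    (hU : Uᴴ * U = 1) (A B : Matrix n n ℂ) :
    ((U * A * Uᴴ) * (U * B * Uᴴ)).trace = (A * B).trace := by
  have h : (U * A * Uᴴ) * (U * B * Uᴴ) = U * (A * (Uᴴ * U) * B * Uᴴ) := by
    simp only [Matrix.mul_assoc]
  rw [h, hU, Matrix.mul_one, Matrix.trace_mul_comm, Matrix.mul_assoc, hU, Matrix.mul_one]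

/-- Measuring the syndrome on the ancillary register and applying the corresponding
correction to the main register recovers the completely noiseless expectation value,
with overall normalisation `∑ⱼ pⱼ²` of second-order purification. -/
theorem vcp_qec_correction_removes_all_noise
    (d K : ℕ)
    (PC : Matrix (Fin d) (Fin d) ℂ)
    (hproj : PC * PC = PC) (hherm : PCᴴ = PC)
    (E : Fin K → Matrix (Fin d) (Fin d) ℂ)
    (hKL : ∀ i j, PC * (E j)ᴴ * E i * PC = if i = j then PC else 0)
    (hunit : ∀ j, (E j)ᴴ * E j = 1)
    (σC : Matrix (Fin d) (Fin d) ℂ)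
    (hσ1 : σC * PC = σC) (hσ2 : PC * σC = σC) (htr : σC.trace = 1)
    (p : Fin K → ℝ)
    (ρ O : Matrix (Fin d) (Fin d) ℂ)
    (T : Matrix (Fin d × Fin d) (Fin d × Fin d) ℂ)
    (hT : T = ∑ i₁, ∑ i₂, ((p i₁ : ℂ) * (p i₂ : ℂ)) •
      ((E i₂ * ρ * (E i₁)ᴴ) ⊗ₖ (E i₁ * σC * (E i₂)ᴴ))) :
    ∑ j, (((E j * O * (E j)ᴴ) ⊗ₖ (E j * PC * (E j)ᴴ)) * T).trace
      = (∑ j, (p j : ℂ) ^ 2) * (O * ρ).trace := by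
  subst hT
  rw [Finset.sum_mul]
  refine Finset.sum_congr rfl fun j _ => ?_
  simp only [Matrix.mul_sum, Matrix.trace_sum, Matrix.mul_smul, Matrix.trace_smul,
    ← Matrix.mul_kronecker_mul, Matrix.trace_kronecker,
    trace_syndrome_mul_of_knillLaflamme hKL hσ1 hσ2, htr]
  rw [Finset.sum_eq_single j (fun a _ ha => by simp [ha]) (by simp),
    Finset.sum_eq_single j (fun b _ hb => by simp [hb]) (by simp)]
  simp [trace_conj_mul_conj (hunit j), sq]
end

section
/- Let G ∈ Matrix (Fin d) (Fin d) ℂ be a Hermitian involution (G·G = 1 and Gᴴ = G), with projectors Π₊ = (1+G)/2 and Π₋ = (1−G)/2, let K be any matrix, and set K₊ = (K + G·K·G)/2 and K₋ = (K − G·K·G)/2. Then for every matrix ρ and each sign s ∈ {+1, −1}: (i) Π_s·K·Π_s·ρ·Π_s·Kᴴ·Π_s = Π_s·K₊·(Π_s·ρ·Π_s)·(K₊)ᴴ·Π_s (even-parity incoherent detector outcome), and (ii) Π_s·K·Π_{−s}·ρ·Π_{−s}·Kᴴ·Π_s = Π_s·K₋·(Π_{−s}·ρ·Π_{−s})·(K₋)ᴴ·Π_s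 (odd-parity incoherent detector outcome). In particular, the incoherent detector removes the noise components of the wrong symmetry but additionally projects the input and output states into eigenspaces of G. -/
open Matrix BigOperators

/-- If two operators `K` and `L` have the same compression between the ranges of Hermitian `P` and
`Q`, then they act identically by conjugation on `Q * ρ * Q` when followed by `P`. -/
theorem Matrix.sandwich_eq_of_compression_eq {n R : Type*} [Fintype n] [Semiring R] [StarRing R]
    {P Q K L : Matrix n n R} (hP : P.IsHermitian) (hQ : Q.IsHermitian)
    (h : P * L * Q = P * K * Q) (ρ : Matrix n n R) :
    P * K * Q * ρ * Q * Kᴴ * P = P * L * (Q * ρ * Q) * Lᴴ * P := by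
  have h' : Q * Lᴴ * P = Q * Kᴴ * P := by
    simpa [conjTranspose_mul, hP.eq, hQ.eq, Matrix.mul_assoc] using congrArg conjTranspose h
  calc P * K * Q * ρ * Q * Kᴴ * P = P * K * Q * ρ * (Q * Kᴴ * P) := by simp only [Matrix.mul_assoc]
    _ = P * L * Q * ρ * (Q * Lᴴ * P) := by rw [h, h']
    _ = P * L * (Q * ρ * Q) * Lᴴ * P := by simp only [Matrix.mul_assoc]

/-- Conjugation by `G` acts on the compression of `K` between eigenspaces of `G` by the product
of the eigenvalues. -/
theorem Matrix.compression_conj_eq_smul {n R : Type*} [Fintype n] [CommSemiring R]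
    {G P Q : Matrix n n R} {a b : R} (hP : P * G = a • P) (hQ : G * Q = b • Q)
    (K : Matrix n n R) : P * (G * K * G) * Q = (a * b) • (P * K * Q) := by
  calc P * (G * K * G) * Q = P * G * K * (G * Q) := by simp only [Matrix.mul_assoc]
    _ = (a * b) • (P * K * Q) := by
      rw [hP, hQ, Matrix.smul_mul, Matrix.smul_mul, Matrix.mul_smul, smul_smul]

/-- The incoherent detector: the even-parity outcome implements `K₊` restricted to
an eigenspace of `G`, and the odd-parity outcome implements `K₋` connecting the
two eigenspaces; both additionally project the input and output states. -/
theorem incoherent_detector_output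
    (d : ℕ) (G : Matrix (Fin d) (Fin d) ℂ)
    (hG : G * G = 1) (hGh : Gᴴ = G)
    (Pp Pm : Matrix (Fin d) (Fin d) ℂ)
    (hPp : Pp = (1 / 2 : ℂ) • (1 + G))
    (hPm : Pm = (1 / 2 : ℂ) • (1 - G))
    (K Kp Km : Matrix (Fin d) (Fin d) ℂ)
    (hKp : Kp = (1 / 2 : ℂ) • (K + G * K * G))
    (hKm : Km = (1 / 2 : ℂ) • (K - G * K * G))
    (ρ : Matrix (Fin d) (Fin d) ℂ) :
    (Pp * K * Pp * ρ * Pp * Kᴴ * Pp = Pp * Kp * (Pp * ρ * Pp) * Kpᴴ * Pp ∧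
     Pm * K * Pm * ρ * Pm * Kᴴ * Pm = Pm * Kp * (Pm * ρ * Pm) * Kpᴴ * Pm) ∧
    (Pp * K * Pm * ρ * Pm * Kᴴ * Pp = Pp * Km * (Pm * ρ * Pm) * Kmᴴ * Pp ∧
     Pm * K * Pp * ρ * Pp * Kᴴ * Pm = Pm * Km * (Pp * ρ * Pp) * Kmᴴ * Pm) := by
  have hPpH : Pp.IsHermitian := by simp [IsHermitian, hPp, conjTranspose_smul, hGh]
  have hPmH : Pm.IsHermitian := by simp [IsHermitian, hPm, conjTranspose_smul, hGh]
  have hPpG : Pp * G = (1 : ℂ) • Pp := by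
    simp [hPp, add_mul, hG, add_comm]
  have hGPp : G * Pp = (1 : ℂ) • Pp := by
    simp [hPp, mul_add, hG, add_comm]
  have hPmG : Pm * G = (-1 : ℂ) • Pm := by
    simp [hPm, sub_mul, hG, ← smul_neg]
  have hGPm : G * Pm = (-1 : ℂ) • Pm := by
    simp [hPm, mul_sub, hG, ← smul_neg]
  have even {P : Matrix (Fin d) (Fin d) ℂ} {a : ℂ} (ha : a * a = 1)
      (hl : P * G = a • P) (hr : G * P = a • P) : P * Kp * P = P * K * P := by
    rw [hKp, Matrix.mul_smul, Matrix.smul_mul, mul_add, add_mul,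
      compression_conj_eq_smul hl hr, ha]
    module
  have odd {P Q : Matrix (Fin d) (Fin d) ℂ} {a b : ℂ} (hab : a * b = -1)
      (hl : P * G = a • P) (hr : G * Q = b • Q) : P * Km * Q = P * K * Q := by
    rw [hKm, Matrix.mul_smul, Matrix.smul_mul, mul_sub, sub_mul,
      compression_conj_eq_smul hl hr, hab]
    module
  exact ⟨⟨sandwich_eq_of_compression_eq hPpH hPpH (even (by norm_num) hPpG hGPp) ρ,
      sandwich_eq_of_compression_eq hPmH hPmH (even (by norm_num) hPmG hGPm) ρ⟩,
    sandwich_eq_of_compression_eq hPpH hPmH (odd (by norm_num) hPpG hGPm) ρ,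
    sandwich_eq_of_compression_eq hPmH hPpH (odd (by norm_num) hPmG hGPp) ρ⟩
end

section
/- Let G ∈ Matrix (Fin d) (Fin d) ℂ be a Hermitian involution (G·G = 1 and Gᴴ = G), with projectors Π₊ = (1+G)/2 and Π₋ = (1−G)/2, let K be any matrix, and set K₊ = (K + G·K·G)/2 and K₋ = (K − G·K·G)/2. Then for every matrix ρ: [Π₊·K·Π₊·ρ·Π₊·Kᴴ·Π₊ + Π₋·K·Π₋·ρ·Π₋·Kᴴ·Π₋] − [Π₊·K·Π₋·ρ·Π₋·Kᴴ·Π₊ + Π₋·K·Π₊·ρ·Π₊·Kᴴ·Π₋] = (1/2)·[ K₊·ρ·(K₊)ᴴ + K₊·(G·ρ·G)·(K₊)ᴴ − K₋·ρ·(K₋)ᴴ − K₋·(G·ρ·G)·(K₋)ᴴ ]. That is, the even-minus-odd combination of the incoherent detector outputs equals a symmetrised mixture of the coherent detector outputs, rather than the coherent detector output itself. -/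
open Matrix BigOperators

/-- The parallelogram identity for the sandwich `X ↦ X * ρ * Xᴴ`, when right multiplication by a
Hermitian `G` turns `A + B` into `A - B`. -/
theorem half_smul_sandwich_add_sandwich_conj {n : Type*} [Fintype n]
    {G A B : Matrix n n ℂ} (hGh : Gᴴ = G) (hAB : (A + B) * G = A - B) (ρ : Matrix n n ℂ) :
    (1 / 2 : ℂ) • ((A + B) * ρ * (A + B)ᴴ + (A + B) * (G * ρ * G) * (A + B)ᴴ)
      = A * ρ * Aᴴ + B * ρ * Bᴴ := by
  have hAB' : G * (A + B)ᴴ = (A - B)ᴴ := by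
    rw [← hAB, conjTranspose_mul, hGh]
  have h : (A + B) * (G * ρ * G) * (A + B)ᴴ = (A - B) * ρ * (A - B)ᴴ := by
    rw [← hAB', ← hAB]
    simp only [Matrix.mul_assoc]
  rw [h, conjTranspose_add, conjTranspose_sub]
  simp only [Matrix.add_mul, Matrix.sub_mul, Matrix.mul_add, Matrix.mul_sub]
  module

/-- The even-minus-odd combination of the incoherent detector outputs equals a
symmetrised mixture of the coherent detector outputs, rather than the coherent
detector output itself. -/
theorem incoherent_detector_even_minus_odd
    (d : ℕ) (G : Matrix (Fin d) (Fin d) ℂ)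
    (hG : G * G = 1) (hGh : Gᴴ = G)
    (Pp Pm : Matrix (Fin d) (Fin d) ℂ)
    (hPp : Pp = (1 / 2 : ℂ) • (1 + G))
    (hPm : Pm = (1 / 2 : ℂ) • (1 - G))
    (K Kp Km : Matrix (Fin d) (Fin d) ℂ)
    (hKp : Kp = (1 / 2 : ℂ) • (K + G * K * G))
    (hKm : Km = (1 / 2 : ℂ) • (K - G * K * G))
    (ρ : Matrix (Fin d) (Fin d) ℂ) :
    (Pp * K * Pp * ρ * Pp * Kᴴ * Pp + Pm * K * Pm * ρ * Pm * Kᴴ * Pm)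
      - (Pp * K * Pm * ρ * Pm * Kᴴ * Pp + Pm * K * Pp * ρ * Pp * Kᴴ * Pm)
    = (1 / 2 : ℂ) • (Kp * ρ * Kpᴴ + Kp * (G * ρ * G) * Kpᴴ
        - Km * ρ * Kmᴴ - Km * (G * ρ * G) * Kmᴴ) := by
  have hPpG : Pp * G = Pp := by
    rw [hPp, smul_mul_assoc, Matrix.add_mul, hG, one_mul, add_comm]
  have hPmG : Pm * G = -Pm := by
    rw [hPm, smul_mul_assoc, Matrix.sub_mul, hG, one_mul, ← smul_neg, neg_sub]
  have hPph : Ppᴴ = Pp := by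
    simp [hPp, hGh]
  have hPmh : Pmᴴ = Pm := by
    simp [hPm, hGh]
  have hKp_blocks : Kp = Pp * K * Pp + Pm * K * Pm := by
    simp only [hKp, hPp, hPm, Matrix.add_mul, Matrix.sub_mul, Matrix.mul_add, Matrix.mul_sub,
      smul_mul_assoc, mul_smul_comm, one_mul, mul_one]
    module
  have hKm_blocks : Km = Pm * K * Pp + Pp * K * Pm := by
    simp only [hKm, hPp, hPm, Matrix.add_mul, Matrix.sub_mul, Matrix.mul_add, Matrix.mul_sub,
      smul_mul_assoc, mul_smul_comm, one_mul, mul_one]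
    module
  have hp := half_smul_sandwich_add_sandwich_conj (A := Pp * K * Pp) (B := Pm * K * Pm) hGh
    (by simp only [Matrix.add_mul, Matrix.mul_assoc, hPpG, hPmG, Matrix.mul_neg, sub_eq_add_neg]) ρ
  have hm := half_smul_sandwich_add_sandwich_conj (A := Pm * K * Pp) (B := Pp * K * Pm) hGh
    (by simp only [Matrix.add_mul, Matrix.mul_assoc, hPpG, hPmG, Matrix.mul_neg, sub_eq_add_neg]) ρ
  rw [← hKp_blocks] at hp
  rw [← hKm_blocks] at hm
  rw [sub_sub, smul_sub, hp, hm]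
  simp only [conjTranspose_mul, hPph, hPmh, Matrix.mul_assoc]
  abel
end

section
/- Let ψ ∈ (Fin d → ℂ) be a unit vector, let E : Fin K → Matrix (Fin d) (Fin d) ℂ satisfy the state-orthogonality condition ⟨ψ, (E_j)ᴴ · E_i · ψ⟩ = δ_{ij} for all i, j ∈ Fin K, and let p : Fin K → ℝ. Define the ancillary state σ = |ψ⟩⟨ψ| (the rank-one matrix ψ ψᴴ) and the noisy verification measurement operator S = ∑_a p_a · E_a · |ψ⟩⟨ψ| · (E_a)ᴴ. Then Tr(E_i · σ · (E_j)ᴴ · S) = p_i · δ_{ij} for all i, j ∈ Fin K. Consequently, using this ancillary state and measurement in the M-copy generalized virtual channel purification circuit suppresses the noise by an additional M−1 orders compared to the trivial measurement. -/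
open Matrix BigOperators

/-- The trace of a product of matrices interleaved with two copies of a rank-one matrix
factors into a product of two sesquilinear matrix elements. -/
lemma trace_mul_vecMulVec_mul_mul_vecMulVec_mul {m n R : Type*} [Fintype m] [Fintype n]
    [CommRing R] (u v : n → R) (A C : Matrix m n R) (B D : Matrix n m R) :
    (A * vecMulVec u v * B * (C * vecMulVec u v * D)).trace =
      (v ⬝ᵥ ((B * C) *ᵥ u)) * (v ⬝ᵥ ((D * A) *ᵥ u)) := by
  rw [mul_vecMulVec, mul_vecMulVec, vecMulVec_mul, vecMulVec_mul, vecMulVec_mul, vecMul_vecMulVec,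
    trace_vecMulVec, dotProduct_smul, smul_eq_mul, dotProduct_comm (A *ᵥ u),
    ← dotProduct_mulVec, ← dotProduct_mulVec, mulVec_mulVec, mulVec_mulVec]

/-- State-verification ancilla: if the Kraus errors map `ψ` to mutually orthogonal
states, then the ancillary state `σ = |ψ⟩⟨ψ|` together with the noisy verification
measurement `S = ℰ(|ψ⟩⟨ψ|)` satisfies `Tr(Eᵢ σ Eⱼᴴ S) = pᵢ δᵢⱼ`. -/
theorem state_verification_purification_condition
    (d K : ℕ) (ψ : Fin d → ℂ) (hψ : star ψ ⬝ᵥ ψ = 1)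
    (E : Fin K → Matrix (Fin d) (Fin d) ℂ)
    (horth : ∀ i j, star ψ ⬝ᵥ (((E j)ᴴ * E i) *ᵥ ψ) = if i = j then 1 else 0)
    (p : Fin K → ℝ)
    (σ S : Matrix (Fin d) (Fin d) ℂ)
    (hσ : σ = Matrix.vecMulVec ψ (star ψ))
    (hS : S = ∑ a, (p a : ℂ) • (E a * σ * (E a)ᴴ)) :
    ∀ i j, (E i * σ * (E j)ᴴ * S).trace = if i = j then (p i : ℂ) else 0 := by
  intro i j
  subst hσ hS
  simp only [Finset.mul_sum, trace_sum, mul_smul_comm, trace_smul,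
    trace_mul_vecMulVec_mul_mul_vecMulVec_mul, horth, smul_eq_mul]
  by_cases h : i = j <;> simp [h]
end

section
/- Let p : Fin K → ℝ be a probability vector (p_i ≥ 0 for all i and ∑_i p_i = 1) with K ≥ 1, and suppose p_0 ≥ p_i for all i (the 0-th component is maximal). Then for every natural number M ≥ 1: ∑_i p_i^M ≤ p_0^M + (1 − p_0)^M. In particular, writing p_0 = e^{−λ}, the purification normalising constant P_M = ∑_i p_i^M satisfies P_M ≤ e^{−Mλ}·(1 + (e^{λ} − 1)^M), so the sampling overhead P_M^{−2} of M-th order virtual channel purification is at least e^{2Mλ}/(1 + (e^{λ}−1)^M)². -/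
open BigOperators

/-- The sum of `M`-th powers of nonnegative reals is at most the `M`-th power of their sum. -/
lemma sum_pow_le_sum_pow_of_nonneg {ι : Type*} (s : Finset ι) (f : ι → ℝ)
    (hf : ∀ i ∈ s, 0 ≤ f i) {M : ℕ} (hM : 1 ≤ M) :
    ∑ i ∈ s, f i ^ M ≤ (∑ i ∈ s, f i) ^ M := by
  obtain ⟨m, rfl⟩ := Nat.exists_eq_add_of_le' hM
  rw [pow_succ', Finset.sum_mul]
  refine Finset.sum_le_sum fun i hi => ?_
  rw [pow_succ']
  exact mul_le_mul_of_nonneg_left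
    (pow_le_pow_left₀ (hf i hi) (Finset.single_le_sum hf hi) m) (hf i hi)

/-- Bound on the purification normalising constant: for a probability vector with
maximal component `p₀`, `P_M = ∑ᵢ pᵢ^M ≤ p₀^M + (1 − p₀)^M`; writing `p₀ = e^{−λ}`
this gives `P_M ≤ e^{−Mλ}(1 + (e^λ − 1)^M)`, hence the sampling overhead `P_M^{−2}`
is at least `e^{2Mλ}/(1 + (e^λ − 1)^M)²`. -/
theorem purification_normalisation_bound
    (K : ℕ) (hK : 0 < K) (p : Fin K → ℝ)
    (hp : ∀ i, 0 ≤ p i) (hsum : ∑ i, p i = 1)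
    (hmax : ∀ i, p i ≤ p ⟨0, hK⟩)
    (M : ℕ) (hM : 1 ≤ M) :
    (∑ i, p i ^ M ≤ p ⟨0, hK⟩ ^ M + (1 - p ⟨0, hK⟩) ^ M) ∧
    ∀ lam : ℝ, p ⟨0, hK⟩ = Real.exp (-lam) →
      (∑ i, p i ^ M ≤ Real.exp (-(M : ℝ) * lam) * (1 + (Real.exp lam - 1) ^ M) ∧
       Real.exp (2 * (M : ℝ) * lam) / (1 + (Real.exp lam - 1) ^ M) ^ 2 ≤
         ((∑ i, p i ^ M) ^ 2)⁻¹) := by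
  have hbound : ∑ i, p i ^ M ≤ p ⟨0, hK⟩ ^ M + (1 - p ⟨0, hK⟩) ^ M := by
    have hrest : ∑ i ∈ Finset.univ.erase ⟨0, hK⟩, p i = 1 - p ⟨0, hK⟩ := by
      rw [← hsum, ← Finset.add_sum_erase _ p (Finset.mem_univ (⟨0, hK⟩ : Fin K))]
      ring
    rw [← Finset.add_sum_erase _ (fun i => p i ^ M) (Finset.mem_univ (⟨0, hK⟩ : Fin K)), ← hrest]
    gcongr
    exact sum_pow_le_sum_pow_of_nonneg _ p (fun i _ => hp i) hM
  refine ⟨hbound, fun lam hlam => ?_⟩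
  have hexp : Real.exp (-(M : ℝ) * lam) = Real.exp (-lam) ^ M := by
    rw [← Real.exp_nat_mul]
    ring_nf
  have hcompl : 1 - Real.exp (-lam) = Real.exp (-lam) * (Real.exp lam - 1) := by
    rw [mul_sub, ← Real.exp_add]
    simp
  have hbound' : ∑ i, p i ^ M ≤ Real.exp (-(M : ℝ) * lam) * (1 + (Real.exp lam - 1) ^ M) := by
    rw [hlam, hcompl, mul_pow] at hbound
    rw [hexp, mul_add, mul_one]
    exact hbound
  refine ⟨hbound', ?_⟩
  have hpos : 0 < ∑ i, p i ^ M :=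
    Finset.sum_pos' (fun i _ => pow_nonneg (hp i) M)
      ⟨⟨0, hK⟩, Finset.mem_univ _, by rw [hlam]; positivity⟩
  have hinv : Real.exp (2 * (M : ℝ) * lam) / (1 + (Real.exp lam - 1) ^ M) ^ 2 =
      ((Real.exp (-(M : ℝ) * lam) * (1 + (Real.exp lam - 1) ^ M)) ^ 2)⁻¹ := by
    rw [mul_pow, mul_inv, ← Real.exp_nat_mul, ← Real.exp_neg, div_eq_mul_inv]
    congr 2
    push_cast
    ring
  rw [hinv]
  exact inv_anti₀ (pow_pos hpos 2) (pow_le_pow_left₀ hpos.le hbound' 2)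
end

section
/- Let n ≥ 2 and for each i ∈ {0, 1, …, n−2} let τ_i denote the adjacent transposition swapping i and i+1 in Fin n. Let σ ∈ Equiv.Perm (Fin (n−1)) be any permutation (ordering) of these indices, and let π be the composite permutation of Fin n obtained by applying the n−1 transpositions τ_{σ(0)}, τ_{σ(1)}, …, τ_{σ(n−2)} in that order, each exactly once. Then π is a derangement: π(x) ≠ x for every x ∈ Fin n. -/
/-- The trajectory of `x` under a product of distinct adjacent transpositions: either `x` is
untouched, or it has been moved to the right across the edge `{x, x + 1}`, or to the left across
the edge `{x - 1, x}`; in the last two cases that edge has been used up. -/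
theorem prod_adjacent_swaps_trichotomy {m : ℕ} (l : List (Fin m)) (hl : l.Nodup)
    (x : Fin (m + 1)) :
    let y := (l.map fun i => Equiv.swap i.castSucc i.succ).prod x
    (y = x ∧ ∀ i ∈ l, i.castSucc ≠ x ∧ i.succ ≠ x) ∨
      (x < y ∧ ∃ i ∈ l, i.castSucc = x) ∨ (y < x ∧ ∃ i ∈ l, i.succ = x) := by
  induction l with
  | nil => simp
  | cons a l ih =>
    obtain ⟨ha, hl⟩ := List.nodup_cons.mp hl
    have key := ih hl
    simp only [List.map_cons, List.prod_cons, Equiv.Perm.mul_apply] at key ⊢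
    generalize (l.map fun i => Equiv.swap i.castSucc i.succ).prod x = y at key ⊢
    rw [Equiv.swap_apply_def]
    rcases key with ⟨rfl, h⟩ | ⟨h, i, hi, rfl⟩ | ⟨h, i, hi, rfl⟩
    · split_ifs with h1 h2
      · exact .inr (.inl ⟨h1 ▸ a.castSucc_lt_succ, a, by simp, h1.symm⟩)
      · exact .inr (.inr ⟨h2 ▸ a.castSucc_lt_succ, a, by simp, h2.symm⟩)
      · refine .inl ⟨rfl, fun i hi => ?_⟩
        rcases List.mem_cons.mp hi with rfl | hi
        · exact ⟨Ne.symm h1, Ne.symm h2⟩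
        · exact h i hi
    · refine .inr (.inl ⟨?_, i, List.mem_cons_of_mem _ hi, rfl⟩)
      have hne : (i : ℕ) ≠ a := fun e => ha (Fin.ext e ▸ hi)
      simp only [Fin.lt_def, Fin.ext_iff, Fin.val_castSucc, Fin.val_succ] at h ⊢
      split_ifs <;> (try simp only [Fin.val_castSucc, Fin.val_succ]) <;> omega
    · refine .inr (.inr ⟨?_, i, List.mem_cons_of_mem _ hi, rfl⟩)
      have hne : (i : ℕ) ≠ a := fun e => ha (Fin.ext e ▸ hi)
      simp only [Fin.lt_def, Fin.ext_iff, Fin.val_castSucc, Fin.val_succ] at h ⊢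
      split_ifs <;> (try simp only [Fin.val_castSucc, Fin.val_succ]) <;> omega

/-- Applying the full set of `n + 1` linear-nearest-neighbour adjacent transpositions
of `Fin (n + 2)` exactly once each, in an arbitrary order `σ`, always yields a
derangement (a permutation with no fixed points). -/
theorem ordered_adjacent_swaps_is_derangement
    (n : ℕ) (σ : Equiv.Perm (Fin (n + 1)))
    (perm : Equiv.Perm (Fin (n + 2)))
    (hperm : perm = (List.ofFn (fun k : Fin (n + 1) =>
        Equiv.swap ((σ k).castSucc) ((σ k).succ))).reverse.prod) :
    ∀ x : Fin (n + 2), perm x ≠ x := by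
  intro x
  have hmap : perm = ((List.ofFn σ).reverse.map fun i => Equiv.swap i.castSucc i.succ).prod := by
    rw [hperm, List.map_reverse, List.map_ofFn]
    rfl
  have hmem : ∀ i, i ∈ (List.ofFn σ).reverse := fun i => by
    rw [List.mem_reverse, List.mem_ofFn]
    exact σ.surjective i
  have key := prod_adjacent_swaps_trichotomy (List.ofFn σ).reverse
    (List.nodup_reverse.mpr (List.nodup_ofFn.mpr σ.injective)) x
  simp only [← hmap] at key
  rcases key with ⟨-, h⟩ | ⟨h, -⟩ | ⟨h, -⟩
  · cases x using Fin.cases with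
    | zero => exact absurd Fin.castSucc_zero (h 0 (hmem 0)).1
    | succ i => exact absurd rfl (h i (hmem i)).2
  · exact h.ne'
  · exact h.ne
end
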